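/- arXiv:1906.10287 — 2 statements merged into one kernel-verified Lean document; each statement's English description precedes it below -/
import Mathlib

section
/- The function Ψ : S^{d-1} × S^{d-1} → ℝ defined by Ψ(η, v) = ∫_Λ (1 - cos(2π h·η)) |h|^{-(d+2s)} (v · h/|h|)² dh, where Λ is a double cone generated by a measurable set Γ ⊆ S^{d-1} of positive surface measure, is continuous and strictly positive, and hence attains a positive minimum on S^{d-1} × S^{d-1}. -/
open MeasureTheory Real
open scoped MeasureTheory

theorem norm_inv_norm_smul_sub_le {E : Type*} [NormedAddCommGroup E] [NormedSpace ℝ E]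
    {t : ℝ} (ht : 0 < t) {x y : E} (hx : t ≤ ‖x‖) (hy : t ≤ ‖y‖) :
    ‖‖x‖⁻¹ • x - ‖y‖⁻¹ • y‖ ≤ 2 / t * ‖x - y‖ := by
  have hx0 : 0 < ‖x‖ := ht.trans_le hx
  have hy0 : 0 < ‖y‖ := ht.trans_le hy
  have hsplit : ‖x‖⁻¹ • x - ‖y‖⁻¹ • y = ‖x‖⁻¹ • (x - y) + (‖x‖⁻¹ - ‖y‖⁻¹) • y := by
    rw [smul_sub, sub_smul]; abel
  have hsnd : ‖(‖x‖⁻¹ - ‖y‖⁻¹) • y‖ = ‖x‖⁻¹ * |‖y‖ - ‖x‖| := by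
    have : ‖x‖⁻¹ - ‖y‖⁻¹ = ‖x‖⁻¹ * (‖y‖ - ‖x‖) * ‖y‖⁻¹ := by field_simp
    rw [norm_smul, this, Real.norm_eq_abs, abs_mul, abs_mul, abs_of_pos (inv_pos.2 hx0),
      abs_of_pos (inv_pos.2 hy0), inv_mul_cancel_right₀ hy0.ne']
  have habs : |‖y‖ - ‖x‖| ≤ ‖x - y‖ := by
    rw [abs_sub_comm]; exact abs_norm_sub_norm_le x y
  calc ‖‖x‖⁻¹ • x - ‖y‖⁻¹ • y‖
      ≤ ‖‖x‖⁻¹ • (x - y)‖ + ‖(‖x‖⁻¹ - ‖y‖⁻¹) • y‖ := hsplit ▸ norm_add_le _ _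
    _ = ‖x‖⁻¹ * (‖x - y‖ + |‖y‖ - ‖x‖|) := by
        rw [hsnd, norm_smul, Real.norm_eq_abs, abs_of_pos (inv_pos.2 hx0), mul_add]
    _ ≤ t⁻¹ * (‖x - y‖ + ‖x - y‖) := by gcongr
    _ = 2 / t * ‖x - y‖ := by ring

/-- The punctured double cone generated by a set of directions. -/
def doubleCone {d : ℕ} (Γ : Set (EuclideanSpace ℝ (Fin d))) : Set (EuclideanSpace ℝ (Fin d)) :=
  {x | x ≠ 0 ∧ ‖x‖⁻¹ • x ∈ Γ ∪ -Γ}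

theorem measurableSet_doubleCone {d : ℕ} {Γ : Set (EuclideanSpace ℝ (Fin d))}
    (hΓ : MeasurableSet Γ) : MeasurableSet (doubleCone Γ) := by
  have hf : Measurable fun x : EuclideanSpace ℝ (Fin d) => ‖x‖⁻¹ • x := by fun_prop
  exact (measurableSet_singleton 0).compl.inter (hf (hΓ.union hΓ.neg))

/-- Almost every slice of a null set by a coordinate hyperplane is null. -/
theorem exists_pos_volume_slice_eq_zero {n : ℕ} {A : Set (EuclideanSpace ℝ (Fin (n + 1)))}
    (hA : MeasurableSet A) (hA0 : volume A = 0) (i : Fin (n + 1)) :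
    ∃ t : ℝ, 0 < t ∧
      volume {y : Fin n → ℝ | WithLp.toLp 2 (i.insertNth t y : Fin (n + 1) → ℝ) ∈ A} = 0 := by
  have hmp := (PiLp.volume_preserving_toLp (Fin (n + 1))).comp
    (volume_preserving_piFinSuccAbove (fun _ : Fin (n + 1) => ℝ) i).symm
  have hpre := hmp.measure_preimage hA.nullMeasurableSet
  rw [hA0, Measure.volume_eq_prod, Measure.measure_prod_null (hmp.measurable hA)] at hpre
  have hpos : (ae ((volume : Measure ℝ).restrict (Set.Ioi (0 : ℝ)))).NeBot := by
    rw [ae_neBot, Ne, Measure.restrict_eq_zero]; simp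
  obtain ⟨t, ht, ht0⟩ := ((ae_restrict_of_ae (s := Set.Ioi (0 : ℝ)) hpre).and
    (ae_restrict_mem measurableSet_Ioi)).exists
  exact ⟨t, ht0, ht⟩

theorem hausdorffMeasure_eq_zero_of_volume_doubleCone_eq_zero {n : ℕ}
    {Γ : Set (EuclideanSpace ℝ (Fin (n + 1)))} (hsub : Γ ⊆ Metric.sphere 0 1)
    (hΓ : MeasurableSet Γ) (h0 : volume (doubleCone Γ) = 0) : μH[(n : ℝ)] Γ = 0 := by
  have hcover : Γ ⊆ ⋃ i, Γ ∩ {x | x i ≠ 0} := by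
    intro x hx
    have hx0 : x ≠ 0 := ne_zero_of_mem_unit_sphere (⟨x, hsub hx⟩ : Metric.sphere _ _)
    obtain ⟨i, hi⟩ : ∃ i, x i ≠ 0 := by
      by_contra! h
      exact hx0 (by ext i; simpa using h i)
    exact Set.mem_iUnion.2 ⟨i, hx, hi⟩
  refine measure_mono_null hcover (measure_iUnion_null fun i => ?_)
  obtain ⟨t, ht, hslice⟩ :=
    exists_pos_volume_slice_eq_zero (measurableSet_doubleCone hΓ) h0 i
  set T := {y : Fin n → ℝ | WithLp.toLp 2 (i.insertNth t y : Fin (n + 1) → ℝ) ∈ doubleCone Γ}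
  let g : (Fin n → ℝ) → EuclideanSpace ℝ (Fin (n + 1)) := fun y =>
    WithLp.toLp 2 (i.insertNth t y : Fin (n + 1) → ℝ)
  let f : (Fin n → ℝ) → EuclideanSpace ℝ (Fin (n + 1)) := fun y => ‖g y‖⁻¹ • g y
  have hgt : ∀ y, t ≤ ‖g y‖ := fun y => by
    have := PiLp.norm_apply_le (g y) i
    simpa [g, abs_of_pos ht] using this
  obtain ⟨C, hC⟩ : ∃ C, LipschitzWith C g := by
    have hins : LipschitzWith 1 fun y : Fin n → ℝ => (i.insertNth t y : Fin (n + 1) → ℝ) := by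
      refine LipschitzWith.of_dist_le_mul fun y z => ?_
      rw [NNReal.coe_one, one_mul, dist_pi_le_iff dist_nonneg]
      refine i.forall_iff_succAbove.2 ⟨by simp, fun j => ?_⟩
      simpa using dist_le_pi_dist y z j
    exact ⟨_, (PiLp.lipschitzWith_toLp 2 _).comp hins⟩
  have hf : LipschitzWith (Real.toNNReal (2 / t) * C) f := by
    refine LipschitzWith.of_dist_le_mul fun y z => ?_
    have hyz := hC.dist_le_mul y z
    rw [dist_eq_norm] at hyz ⊢
    rw [NNReal.coe_mul, Real.coe_toNNReal _ (by positivity), mul_assoc]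
    exact (norm_inv_norm_smul_sub_le ht (hgt y) (hgt z)).trans (by gcongr)
  have hT : μH[(n : ℝ)] T = 0 := by
    have := hausdorffMeasure_pi_real (ι := Fin n)
    rw [Fintype.card_fin] at this
    rw [this, hslice]
  have himage : ∀ {f : (Fin n → ℝ) → EuclideanSpace ℝ (Fin (n + 1))} {K}, LipschitzWith K f →
      μH[(n : ℝ)] (f '' T) = 0 := fun hf => by
    have := (hf.lipschitzOnWith (s := T)).hausdorffMeasure_image_le (Nat.cast_nonneg n)
    rw [hT, mul_zero] at this
    exact le_antisymm this bot_le
  refine measure_mono_null ?_ (measure_union_null (himage hf) (himage hf.neg))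
  rintro x ⟨hx, hxi : x i ≠ 0⟩
  have hx1 : ‖x‖ = 1 := by simpa using hsub hx
  let y : Fin n → ℝ := fun j => t / x i * x (i.succAbove j)
  have hgy : g y = (t / x i) • x := by
    ext k
    revert k
    refine i.forall_iff_succAbove.2 ⟨by simp [g, hxi], fun j => by simp [g, y]⟩
  have hfy : f y = x ∨ f y = -x := by
    simp only [f, hgy, norm_smul, hx1, mul_one, smul_smul, Real.norm_eq_abs]
    have hq : t / x i ≠ 0 := div_ne_zero ht.ne' hxi
    rcases abs_choice (t / x i) with h | h <;> rw [h]
    · left; rw [inv_mul_cancel₀ hq, one_smul]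
    · right; rw [inv_neg, neg_mul, inv_mul_cancel₀ hq, neg_smul, one_smul]
  have hy : y ∈ T := by
    refine ⟨norm_pos_iff.1 (ht.trans_le (hgt y)), ?_⟩
    change f y ∈ Γ ∪ -Γ
    rcases hfy with h | h <;> rw [h]
    · exact Or.inl hx
    · exact Or.inr (by simpa using hx)
  rcases hfy with h | h
  · exact Or.inl ⟨y, hy, h⟩
  · exact Or.inr ⟨y, hy, by simp [h]⟩

theorem volume_inner_eq_const_eq_zero {E : Type*} [NormedAddCommGroup E] [InnerProductSpace ℝ E]
    [FiniteDimensional ℝ E] [MeasurableSpace E] [BorelSpace E] {v : E} (hv : v ≠ 0) (c : ℝ) :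
    volume {x : E | inner ℝ v x = c} = 0 := by
  let H : AffineSubspace ℝ E :=
    { carrier := {x | inner ℝ v x = c}
      smul_vsub_vadd_mem' := by
        intro a x y z hx hy hz
        simp only [Set.mem_ofPred_eq] at hx hy hz ⊢
        simp [inner_add_right, inner_sub_right, inner_smul_right, hx, hy, hz] }
  refine Measure.addHaar_affineSubspace volume H fun hH => ?_
  have hmem : ∀ x : E, inner ℝ v x = c := fun x =>
    show x ∈ H from hH ▸ AffineSubspace.mem_top ℝ E x
  have h0 := hmem 0
  rw [inner_zero_right] at h0
  exact hv (inner_self_eq_zero.1 ((hmem v).trans h0.symm))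

theorem sum_mul_eq_inner {d : ℕ} (x y : EuclideanSpace ℝ (Fin d)) :
    ∑ i, x i * y i = inner ℝ x y := by
  simp [PiLp.inner_apply, mul_comm]

theorem integrable_min_mul_norm_rpow {d : ℕ} (hd : 1 ≤ d) {s : ℝ} (hs : s ∈ Set.Ioo (0 : ℝ) 1)
    (a b : ℝ) (ha : 0 ≤ a) (hb : 0 ≤ b) :
    Integrable fun h : EuclideanSpace ℝ (Fin d) =>
      min a (b * ‖h‖ ^ 2) * ‖h‖ ^ (-((d : ℝ) + 2 * s)) := by
  have : Nonempty (Fin d) := ⟨⟨0, hd⟩⟩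
  refine (integrable_fun_norm_addHaar volume
    (f := fun r : ℝ => min a (b * r ^ 2) * r ^ (-((d : ℝ) + 2 * s)))).2 ?_
  rw [finrank_euclideanSpace_fin]
  have hpow : ∀ r : ℝ, 0 < r → r ^ (d - 1) * r ^ (-((d : ℝ) + 2 * s)) = r ^ (-1 - 2 * s) := by
    intro r hr
    rw [← Real.rpow_natCast, ← Real.rpow_add hr]
    push_cast [hd]
    ring_nf
  have hmeas : Measurable fun r : ℝ =>
      r ^ (d - 1) • (min a (b * r ^ 2) * r ^ (-((d : ℝ) + 2 * s))) := by fun_prop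
  rw [← Set.Ioc_union_Ioi_eq_Ioi zero_le_one]
  refine IntegrableOn.union ?_ ?_
  · have hint : IntegrableOn (fun r : ℝ => b * r ^ (1 - 2 * s)) (Set.Ioc 0 1) :=
      ((intervalIntegrable_iff_integrableOn_Ioc_of_le zero_le_one).1
        (intervalIntegral.intervalIntegrable_rpow' (by linarith [hs.2]))).const_mul b
    refine hint.mono' hmeas.aestronglyMeasurable
      ((ae_restrict_mem measurableSet_Ioc).mono fun r hr => ?_)
    have hr0 : 0 < r := hr.1
    rw [Real.norm_of_nonneg (by positivity), smul_eq_mul, mul_left_comm, hpow r hr0]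
    calc min a (b * r ^ 2) * r ^ (-1 - 2 * s) ≤ b * r ^ 2 * r ^ (-1 - 2 * s) := by
          gcongr; exact min_le_right _ _
      _ = b * r ^ (1 - 2 * s) := by
          rw [mul_assoc, ← Real.rpow_natCast, ← Real.rpow_add hr0]; push_cast; ring_nf
  · have hint : IntegrableOn (fun r : ℝ => a * r ^ (-1 - 2 * s)) (Set.Ioi 1) :=
      (integrableOn_Ioi_rpow_of_lt (by linarith [hs.1]) one_pos).const_mul a
    refine hint.mono' hmeas.aestronglyMeasurable
      ((ae_restrict_mem measurableSet_Ioi).mono fun r hr => ?_)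
    have hr0 : 0 < r := one_pos.trans hr
    rw [Real.norm_of_nonneg (by positivity), smul_eq_mul, mul_left_comm, hpow r hr0]
    gcongr; exact min_le_left _ _

/-- The integrand defining `Ψ`. -/
noncomputable def coneIntegrand {d : ℕ} (s : ℝ) (η v h : EuclideanSpace ℝ (Fin d)) : ℝ :=
  (1 - Real.cos (2 * Real.pi * ∑ i, h i * η i)) * ‖h‖ ^ (-((d : ℝ) + 2 * s)) *
    ((∑ i, v i * h i) / ‖h‖) ^ 2

theorem coneIntegrand_nonneg {d : ℕ} (s : ℝ) (η v h : EuclideanSpace ℝ (Fin d)) :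
    0 ≤ coneIntegrand s η v h := by
  have := sub_nonneg.2 (Real.cos_le_one (2 * Real.pi * ∑ i, h i * η i))
  unfold coneIntegrand
  positivity

theorem measurable_coneIntegrand {d : ℕ} (s : ℝ) (η v : EuclideanSpace ℝ (Fin d)) :
    Measurable (coneIntegrand s η v) := by
  unfold coneIntegrand
  fun_prop

theorem continuous_coneIntegrand {d : ℕ} (s : ℝ) (h : EuclideanSpace ℝ (Fin d)) :
    Continuous fun p : EuclideanSpace ℝ (Fin d) × EuclideanSpace ℝ (Fin d) =>
      coneIntegrand s p.1 p.2 h := by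
  unfold coneIntegrand
  fun_prop

theorem norm_coneIntegrand_le {d : ℕ} (s : ℝ) {η v : EuclideanSpace ℝ (Fin d)}
    (hη : ‖η‖ = 1) (hv : ‖v‖ = 1) (h : EuclideanSpace ℝ (Fin d)) :
    ‖coneIntegrand s η v h‖ ≤
      min 2 (2 * Real.pi ^ 2 * ‖h‖ ^ 2) * ‖h‖ ^ (-((d : ℝ) + 2 * s)) := by
  rw [Real.norm_of_nonneg (coneIntegrand_nonneg s η v h), coneIntegrand, sum_mul_eq_inner,
    sum_mul_eq_inner]
  have hcos0 := sub_nonneg.2 (Real.cos_le_one (2 * Real.pi * inner ℝ h η))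
  have hinner : (inner ℝ h η) ^ 2 ≤ ‖h‖ ^ 2 := by
    have := abs_real_inner_le_norm h η
    rw [hη, mul_one] at this
    exact sq_le_sq' (abs_le.1 this).1 (abs_le.1 this).2
  have hcos : 1 - Real.cos (2 * Real.pi * inner ℝ h η) ≤ min 2 (2 * Real.pi ^ 2 * ‖h‖ ^ 2) := by
    refine le_min (by linarith [Real.neg_one_le_cos (2 * Real.pi * inner ℝ h η)]) ?_
    calc 1 - Real.cos (2 * Real.pi * inner ℝ h η)
        ≤ (2 * Real.pi * inner ℝ h η) ^ 2 / 2 := by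
          linarith [Real.one_sub_sq_div_two_le_cos (x := 2 * Real.pi * inner ℝ h η)]
      _ = 2 * Real.pi ^ 2 * (inner ℝ h η) ^ 2 := by ring
      _ ≤ _ := by gcongr
  have hdir : (inner ℝ v h / ‖h‖) ^ 2 ≤ 1 := by
    have := abs_real_inner_le_norm v h
    rw [hv, one_mul] at this
    rw [sq_le_one_iff_abs_le_one, abs_div, abs_norm]
    exact div_le_one_of_le₀ this (norm_nonneg h)
  calc _ ≤ min 2 (2 * Real.pi ^ 2 * ‖h‖ ^ 2) * ‖h‖ ^ (-((d : ℝ) + 2 * s)) * 1 := by gcongr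
    _ = _ := mul_one _

theorem ae_coneIntegrand_ne_zero {d : ℕ} (s : ℝ) {η v : EuclideanSpace ℝ (Fin d)}
    (hη : η ≠ 0) (hv : v ≠ 0) : ∀ᵐ h, coneIntegrand s η v h ≠ 0 := by
  have hplane : ∀ {w : EuclideanSpace ℝ (Fin d)}, w ≠ 0 → ∀ c : ℝ, ∀ᵐ h, inner ℝ w h ≠ c :=
    fun hw c => by simpa [ae_iff] using volume_inner_eq_const_eq_zero hw c
  filter_upwards [ae_all_iff.2 fun k : ℤ => hplane hη k, hplane hv 0] with h hk hvh
  have hh : h ≠ 0 := by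
    rintro rfl
    exact hvh (inner_zero_right v)
  have hnorm := norm_pos_iff.2 hh
  rw [coneIntegrand, sum_mul_eq_inner, sum_mul_eq_inner]
  refine mul_ne_zero (mul_ne_zero (fun hcos => ?_) (Real.rpow_pos_of_pos hnorm _).ne')
    (pow_ne_zero 2 (div_ne_zero hvh hnorm.ne'))
  obtain ⟨k, hk'⟩ := (Real.cos_eq_one_iff _).1 (sub_eq_zero.1 hcos).symm
  refine hk k ?_
  rw [real_inner_comm]
  have hpi : (2 * Real.pi : ℝ) ≠ 0 := by positivity
  exact mul_left_cancel₀ hpi (by linarith)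

theorem integrable_cone_bound {d : ℕ} (hd : 1 ≤ d) {s : ℝ} (hs : s ∈ Set.Ioo (0 : ℝ) 1)
    (A : Set (EuclideanSpace ℝ (Fin d))) :
    IntegrableOn (fun h : EuclideanSpace ℝ (Fin d) =>
      min 2 (2 * Real.pi ^ 2 * ‖h‖ ^ 2) * ‖h‖ ^ (-((d : ℝ) + 2 * s))) A :=
  (integrable_min_mul_norm_rpow hd hs 2 (2 * Real.pi ^ 2) (by positivity)
    (by positivity)).integrableOn

theorem continuousOn_setIntegral_coneIntegrand {d : ℕ} (hd : 1 ≤ d) {s : ℝ}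
    (hs : s ∈ Set.Ioo (0 : ℝ) 1) (A : Set (EuclideanSpace ℝ (Fin d))) :
    ContinuousOn (fun p : EuclideanSpace ℝ (Fin d) × EuclideanSpace ℝ (Fin d) =>
      ∫ h in A, coneIntegrand s p.1 p.2 h) (Metric.sphere 0 1 ×ˢ Metric.sphere 0 1) := by
  refine continuousOn_of_dominated
    (fun p _ => (measurable_coneIntegrand s p.1 p.2).aestronglyMeasurable)
    (fun p hp => ae_of_all _ fun h => ?_) (integrable_cone_bound hd hs A)
    (ae_of_all _ fun h => (continuous_coneIntegrand s h).continuousOn)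
  obtain ⟨hη, hv⟩ := Set.mem_prod.1 hp
  exact norm_coneIntegrand_le s (mem_sphere_zero_iff_norm.1 hη) (mem_sphere_zero_iff_norm.1 hv) h

theorem setIntegral_coneIntegrand_pos {d : ℕ} (hd : 1 ≤ d) {s : ℝ}
    (hs : s ∈ Set.Ioo (0 : ℝ) 1) {A : Set (EuclideanSpace ℝ (Fin d))} (hA : volume A ≠ 0)
    {η v : EuclideanSpace ℝ (Fin d)} (hη : ‖η‖ = 1) (hv : ‖v‖ = 1) :
    0 < ∫ h in A, coneIntegrand s η v h := by
  have hη0 : η ≠ 0 := norm_ne_zero_iff.1 (hη ▸ one_ne_zero)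
  have hv0 : v ≠ 0 := norm_ne_zero_iff.1 (hv ▸ one_ne_zero)
  have hint : IntegrableOn (coneIntegrand s η v) A :=
    (integrable_cone_bound hd hs A).mono' (measurable_coneIntegrand s η v).aestronglyMeasurable
      (ae_of_all _ fun h => norm_coneIntegrand_le s hη hv h)
  rw [setIntegral_pos_iff_support_of_nonneg_ae
    (ae_of_all _ fun h => coneIntegrand_nonneg s η v h) hint, Set.inter_comm,
    measure_inter_conull (by
      simpa [ae_iff, Function.support, Set.compl_def] using ae_coneIntegrand_ne_zero s hη0 hv0)]
  exact pos_iff_ne_zero.2 hA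

theorem volume_doubleCone_ne_zero {d : ℕ} (hd : 1 ≤ d) {Γ : Set (EuclideanSpace ℝ (Fin d))}
    (hsub : Γ ⊆ Metric.sphere 0 1) (hΓ : MeasurableSet Γ) (hpos : 0 < μH[(d : ℝ) - 1] Γ) :
    volume (doubleCone Γ) ≠ 0 := by
  obtain ⟨n, rfl⟩ := Nat.exists_eq_add_of_le' hd
  refine fun h0 => hpos.ne' ?_
  rw [Nat.cast_add, Nat.cast_one, add_sub_cancel_right]
  exact hausdorffMeasure_eq_zero_of_volume_doubleCone_eq_zero hsub hΓ h0

/-- The function `Ψ(η, v) = ∫_Λ (1 - cos(2π h·η)) |h|^{-(d+2s)} (v · h/|h|)² dh`, with `Λ`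
the double cone generated by a measurable `Γ ⊆ S^{d-1}` of positive surface measure, is
continuous and strictly positive on `S^{d-1} × S^{d-1}`, hence attains a positive minimum. -/
theorem Psi_continuous_positive_attains_min
    (d : ℕ) (hd : 1 ≤ d) (s : ℝ) (hs : s ∈ Set.Ioo (0:ℝ) 1)
    (Γ : Set (EuclideanSpace ℝ (Fin d)))
    (hΓsub : Γ ⊆ Metric.sphere (0 : EuclideanSpace ℝ (Fin d)) 1)
    (hΓmeas : MeasurableSet Γ) (hΓpos : 0 < μH[(d : ℝ) - 1] Γ) :
    let S := Metric.sphere (0 : EuclideanSpace ℝ (Fin d)) 1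
    let Ψ : EuclideanSpace ℝ (Fin d) → EuclideanSpace ℝ (Fin d) → ℝ := fun η v =>
      ∫ h in {x : EuclideanSpace ℝ (Fin d) | x ≠ 0 ∧ ‖x‖⁻¹ • x ∈ Γ ∪ -Γ},
        (1 - Real.cos (2 * Real.pi * ∑ i, h i * η i)) * ‖h‖ ^ (-((d : ℝ) + 2 * s)) *
          ((∑ i, v i * h i) / ‖h‖) ^ 2
    ContinuousOn (fun p : EuclideanSpace ℝ (Fin d) × EuclideanSpace ℝ (Fin d) => Ψ p.1 p.2)
        (S ×ˢ S) ∧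
    (∀ η ∈ S, ∀ v ∈ S, 0 < Ψ η v) ∧
    (∃ η₀ ∈ S, ∃ v₀ ∈ S, 0 < Ψ η₀ v₀ ∧ ∀ η ∈ S, ∀ v ∈ S, Ψ η₀ v₀ ≤ Ψ η v) := by
  intro S Ψ
  have hcont : ContinuousOn
      (fun p : EuclideanSpace ℝ (Fin d) × EuclideanSpace ℝ (Fin d) => Ψ p.1 p.2) (S ×ˢ S) :=
    continuousOn_setIntegral_coneIntegrand hd hs (doubleCone Γ)
  have hpos : ∀ η ∈ S, ∀ v ∈ S, 0 < Ψ η v := fun η hη v hv =>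
    setIntegral_coneIntegrand_pos hd hs (volume_doubleCone_ne_zero hd hΓsub hΓmeas hΓpos)
      (mem_sphere_zero_iff_norm.1 hη) (mem_sphere_zero_iff_norm.1 hv)
  clear_value Ψ
  obtain ⟨x, hx⟩ : Γ.Nonempty := nonempty_of_measure_ne_zero hΓpos.ne'
  have hS : IsCompact S := isCompact_sphere 0 1
  obtain ⟨⟨η₀, v₀⟩, hp, hmin⟩ := (hS.prod hS).exists_isMinOn
    ⟨(x, x), Set.mk_mem_prod (hΓsub hx) (hΓsub hx)⟩ hcont
  obtain ⟨hη₀, hv₀⟩ := Set.mem_prod.1 hp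
  exact ⟨hcont, hpos, η₀, hη₀, v₀, hv₀, hpos _ hη₀ _ hv₀,
    fun η hη v hv => isMinOn_iff.1 hmin (η, v) (Set.mk_mem_prod hη hv)⟩
end

section
/- For s ∈ (0,1), the Fourier symbol of the operator -(-Δ̊)^s u(x) = p.v.∫_{ℝ^d} |y|^{-(d+2s)}(y⊗y/|y|²)(u(x+y)-u(x)) dy is -M^Δ_s(ξ), where M^Δ_s(ξ) = (2π|ξ|)^{2s}( ℓ₁ I + ℓ₂ (ξ⊗ξ/|ξ|²) ) for two positive constants ℓ₁, ℓ₂ depending only on d and s. -/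
open MeasureTheory Real

section LameForm

open Module Submodule
open scoped RealInnerProductSpace

variable {E : Type*} [NormedAddCommGroup E] [InnerProductSpace ℝ E]

/-- The integrand of the symbol of the fractional Navier–Lamé operator, as a bilinear form in
`u` and `v`. -/
noncomputable def lameIntegrand (s : ℝ) (ξ u v y : E) : ℝ :=
  (⟪y, u⟫ * ⟪y, v⟫ / ‖y‖ ^ 2) * (1 - cos (2 * π * ⟪y, ξ⟫)) * ‖y‖ ^ (-((finrank ℝ E : ℝ) + 2 * s))

/-- The truncated kernel which dominates the integrand of the Navier–Lamé symbol. -/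
noncomputable def truncatedKernel (s : ℝ) (y : E) : ℝ :=
  min 1 (‖y‖ ^ 2) * ‖y‖ ^ (-((finrank ℝ E : ℝ) + 2 * s))

theorem reflection_sub_apply_of_inner_eq_zero {v w x : E} (hv : ⟪v, x⟫ = 0) (hw : ⟪w, x⟫ = 0) :
    reflection (ℝ ∙ (v - w))ᗮ x = x :=
  reflection_mem_subspace_eq_self <| mem_orthogonal_singleton_iff_inner_right.2 <| by
    rw [inner_sub_left, hv, hw, sub_zero]

theorem truncatedKernel_nonneg (s : ℝ) (y : E) : 0 ≤ truncatedKernel s y := by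
  unfold truncatedKernel
  positivity

theorem one_sub_cos_le_mul_min (a b : ℝ) :
    1 - cos (a * b) ≤ (2 + a ^ 2) * min 1 (b ^ 2) := by
  have h1 := one_sub_sq_div_two_le_cos (x := a * b)
  have h2 := neg_one_le_cos (a * b)
  rcases le_total 1 (b ^ 2) with h | h
  · rw [min_eq_left h]; nlinarith [sq_nonneg a]
  · rw [min_eq_right h]; nlinarith [mul_nonneg (sq_nonneg a) (sq_nonneg b), sq_nonneg b]

theorem abs_lameIntegrand_smul_le (s t : ℝ) (ξ u v y : E) :
    |lameIntegrand s (t • ξ) u v y| ≤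
      (‖u‖ * ‖v‖ * (2 + (2 * π * ‖ξ‖) ^ 2 * t ^ 2)) * truncatedKernel s y := by
  rcases eq_or_ne y 0 with rfl | hy
  · simp only [lameIntegrand, inner_zero_left, zero_mul, zero_div, abs_zero]
    have := truncatedKernel_nonneg s (0 : E)
    positivity
  have hy' : 0 < ‖y‖ := norm_pos_iff.2 hy
  have hP : |⟪y, u⟫ * ⟪y, v⟫ / ‖y‖ ^ 2| ≤ ‖u‖ * ‖v‖ := by
    rw [abs_div, abs_mul, abs_of_pos (pow_pos hy' 2), div_le_iff₀ (pow_pos hy' 2)]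
    calc |⟪y, u⟫| * |⟪y, v⟫| ≤ (‖y‖ * ‖u‖) * (‖y‖ * ‖v‖) := by
          gcongr <;> exact abs_real_inner_le_norm _ _
      _ = _ := by ring
  have hc0 : 0 ≤ 1 - cos (2 * π * ⟪y, t • ξ⟫) := by linarith [cos_le_one (2 * π * ⟪y, t • ξ⟫)]
  have hC : 1 - cos (2 * π * ⟪y, t • ξ⟫) ≤
      (2 + (2 * π * ‖ξ‖) ^ 2 * t ^ 2) * min 1 (‖y‖ ^ 2) := by
    have h1 := one_sub_cos_le_mul_min (2 * π * (⟪y, t • ξ⟫ / ‖y‖)) ‖y‖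
    have h2 : 2 * π * (⟪y, t • ξ⟫ / ‖y‖) * ‖y‖ = 2 * π * ⟪y, t • ξ⟫ := by
      field_simp
    rw [h2] at h1
    refine h1.trans ?_
    have h3 : |⟪y, t • ξ⟫ / ‖y‖| ≤ |t| * ‖ξ‖ := by
      rw [abs_div, abs_of_pos hy', div_le_iff₀ hy']
      calc _ ≤ ‖y‖ * ‖t • ξ‖ := abs_real_inner_le_norm _ _
        _ = _ := by rw [norm_smul, norm_eq_abs]; ring
    have h4 : (⟪y, t • ξ⟫ / ‖y‖) ^ 2 ≤ (|t| * ‖ξ‖) ^ 2 := by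
      rw [← sq_abs]; gcongr
    gcongr
    calc (2 * π * (⟪y, t • ξ⟫ / ‖y‖)) ^ 2 = (2 * π) ^ 2 * (⟪y, t • ξ⟫ / ‖y‖) ^ 2 := by ring
      _ ≤ (2 * π) ^ 2 * (|t| * ‖ξ‖) ^ 2 := by gcongr
      _ = _ := by rw [mul_pow |t|, sq_abs]; ring
  have hk : 0 ≤ ‖y‖ ^ (-((finrank ℝ E : ℝ) + 2 * s)) := by positivity
  rw [lameIntegrand, abs_mul, abs_mul, abs_of_nonneg hc0, abs_of_nonneg hk, truncatedKernel]
  calc _ ≤ (‖u‖ * ‖v‖) * ((2 + (2 * π * ‖ξ‖) ^ 2 * t ^ 2) * min 1 (‖y‖ ^ 2)) *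
        ‖y‖ ^ (-((finrank ℝ E : ℝ) + 2 * s)) := by gcongr
    _ = _ := by ring

variable [MeasurableSpace E] [BorelSpace E]

theorem measurable_truncatedKernel (s : ℝ) : Measurable (truncatedKernel (E := E) s) := by
  unfold truncatedKernel
  fun_prop

variable [FiniteDimensional ℝ E]

/-- The symbol of the fractional Navier–Lamé operator, as a bilinear form in `u` and `v`. -/
noncomputable def lameForm (s : ℝ) (ξ u v : E) : ℝ := ∫ y : E, lameIntegrand s ξ u v y

theorem measurable_lameIntegrand (s : ℝ) (ξ u v : E) : Measurable (lameIntegrand s ξ u v) := by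
  unfold lameIntegrand
  fun_prop

theorem integrable_truncatedKernel [Nontrivial E] {s : ℝ} (hs : s ∈ Set.Ioo (0 : ℝ) 1) :
    Integrable (truncatedKernel (E := E) s) := by
  have hn : 1 ≤ finrank ℝ E := finrank_pos
  have key := integrable_fun_norm_addHaar (volume : Measure E)
    (f := fun r : ℝ ↦ min 1 (r ^ 2) * r ^ (-((finrank ℝ E : ℝ) + 2 * s)))
  refine key.2 ?_
  have hpow : ∀ r : ℝ, 0 < r →
      r ^ (finrank ℝ E - 1) * r ^ (-((finrank ℝ E : ℝ) + 2 * s)) = r ^ (-1 - 2 * s) := by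
    intro r hr
    rw [← rpow_natCast, ← rpow_add hr]
    congr 1
    push_cast [hn]
    ring
  rw [← Set.Ioc_union_Ioi_eq_Ioi zero_le_one]
  refine IntegrableOn.union ?_ ?_
  · have h1 : IntegrableOn (fun r : ℝ ↦ r ^ (1 - 2 * s)) (Set.Ioc 0 1) :=
      (intervalIntegrable_iff_integrableOn_Ioc_of_le zero_le_one).1
        (intervalIntegral.intervalIntegrable_rpow' (by linarith [hs.2]))
    refine h1.congr_fun (fun r hr ↦ ?_) measurableSet_Ioc
    have hr2 : min 1 (r ^ 2) = r ^ 2 := min_eq_right (by nlinarith [hr.1, hr.2])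
    simp only [smul_eq_mul, hr2]
    rw [mul_left_comm, hpow r hr.1, ← rpow_natCast, ← rpow_add hr.1]
    congr 1
    push_cast
    ring
  · have h1 : IntegrableOn (fun r : ℝ ↦ r ^ (-1 - 2 * s)) (Set.Ioi 1) :=
      integrableOn_Ioi_rpow_of_lt (by linarith [hs.1]) zero_lt_one
    refine h1.congr_fun (fun r hr ↦ ?_) measurableSet_Ioi
    have hr : 1 < r := hr
    have hr2 : min 1 (r ^ 2) = 1 := min_eq_left (by nlinarith)
    simp only [smul_eq_mul, hr2, one_mul]
    rw [hpow r (by linarith)]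

theorem integrable_lameIntegrand [Nontrivial E] {s : ℝ} (hs : s ∈ Set.Ioo (0 : ℝ) 1)
    (ξ u v : E) : Integrable (lameIntegrand s ξ u v) := by
  refine ((integrable_truncatedKernel hs).const_mul
    (‖u‖ * ‖v‖ * (2 + (2 * π * ‖ξ‖) ^ 2 * 1 ^ 2))).mono'
    (measurable_lameIntegrand s ξ u v).aestronglyMeasurable (.of_forall fun y ↦ ?_)
  simpa using abs_lameIntegrand_smul_le s 1 ξ u v y

theorem lameForm_comm (s : ℝ) (ξ u v : E) : lameForm s ξ u v = lameForm s ξ v u := by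
  simp only [lameForm, lameIntegrand, mul_comm]

theorem lameForm_add_left [Nontrivial E] {s : ℝ} (hs : s ∈ Set.Ioo (0 : ℝ) 1) (ξ u u' v : E) :
    lameForm s ξ (u + u') v = lameForm s ξ u v + lameForm s ξ u' v := by
  rw [lameForm, lameForm, lameForm, ← integral_add (integrable_lameIntegrand hs _ _ _)
    (integrable_lameIntegrand hs _ _ _)]
  congr 1 with y
  simp only [lameIntegrand, inner_add_right]
  ring

theorem lameForm_smul_left (s a : ℝ) (ξ u v : E) :
    lameForm s ξ (a • u) v = a * lameForm s ξ u v := by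
  rw [lameForm, lameForm, ← integral_const_mul]
  congr 1 with y
  simp only [lameIntegrand, inner_smul_right]
  ring

theorem lameForm_map (s : ℝ) (L : E ≃ₗᵢ[ℝ] E) (ξ u v : E) :
    lameForm s (L ξ) (L u) (L v) = lameForm s ξ u v := by
  rw [lameForm, ← L.measurePreserving.integral_comp L.toHomeomorph.measurableEmbedding]
  simp [lameForm, lameIntegrand]

theorem lameForm_smul_of_pos (s : ℝ) {t : ℝ} (ht : 0 < t) (ξ u v : E) :
    lameForm s (t • ξ) u v = t ^ (2 * s) * lameForm s ξ u v := by
  have h := Measure.integral_comp_smul (volume : Measure E) (lameIntegrand s ξ u v) t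
  have h1 : ∀ y : E, lameIntegrand s ξ u v (t • y) =
      t ^ (-((finrank ℝ E : ℝ) + 2 * s)) * lameIntegrand s (t • ξ) u v y := by
    intro y
    simp only [lameIntegrand, inner_smul_left, inner_smul_right, norm_smul, norm_eq_abs,
      abs_of_pos ht, conj_trivial, mul_rpow ht.le (norm_nonneg y)]
    rw [show t * ⟪y, u⟫ * (t * ⟪y, v⟫) / (t * ‖y‖) ^ 2 = ⟪y, u⟫ * ⟪y, v⟫ / ‖y‖ ^ 2 by
      rw [show t * ⟪y, u⟫ * (t * ⟪y, v⟫) = t ^ 2 * (⟪y, u⟫ * ⟪y, v⟫) by ring, mul_pow,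
        mul_div_mul_left _ _ (by positivity)]]
    ring
  simp only [h1, integral_const_mul, smul_eq_mul] at h
  rw [abs_of_pos (by positivity), neg_add, rpow_add ht, rpow_neg ht.le, rpow_natCast,
    mul_assoc] at h
  have h2 := mul_left_cancel₀ (by positivity) h
  rw [rpow_neg ht.le, inv_mul_eq_iff_eq_mul₀ (by positivity)] at h2
  exact h2

theorem lameForm_neg (s : ℝ) (ξ u v : E) : lameForm s (-ξ) u v = lameForm s ξ u v := by
  simp [lameForm, lameIntegrand]

theorem lameForm_zero (s : ℝ) (u v : E) : lameForm s 0 u v = 0 := by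
  simp [lameForm, lameIntegrand]

theorem lameForm_smul {s : ℝ} (hs : 0 < s) (t : ℝ) (ξ u v : E) :
    lameForm s (t • ξ) u v = |t| ^ (2 * s) * lameForm s ξ u v := by
  rcases lt_trichotomy t 0 with ht | rfl | ht
  · rw [← lameForm_neg, ← neg_smul, lameForm_smul_of_pos s (neg_pos.2 ht), abs_of_neg ht]
  · rw [zero_smul, lameForm_zero, abs_zero, zero_rpow (by positivity), zero_mul]
  · rw [lameForm_smul_of_pos s ht, abs_of_pos ht]

theorem lameForm_self_pos [Nontrivial E] {s : ℝ} (hs : s ∈ Set.Ioo (0 : ℝ) 1) {ξ u y₀ : E}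
    (hu : ⟪y₀, u⟫ ≠ 0) (hξ : cos (2 * π * ⟪y₀, ξ⟫) ≠ 1) : 0 < lameForm s ξ u u := by
  refine (integral_pos_iff_support_of_nonneg (fun y ↦ ?_) (integrable_lameIntegrand hs ξ u u)).2 ?_
  · have := cos_le_one (2 * π * ⟪y, ξ⟫)
    have := mul_self_nonneg ⟪y, u⟫
    simp only [lameIntegrand, Pi.zero_apply]
    have : 0 ≤ 1 - cos (2 * π * ⟪y, ξ⟫) := by linarith
    positivity
  · have ho : IsOpen {y : E | ⟪y, u⟫ ≠ 0 ∧ cos (2 * π * ⟪y, ξ⟫) ≠ 1} :=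
      (isOpen_ne_fun (by fun_prop) (by fun_prop)).inter (isOpen_ne_fun (by fun_prop) (by fun_prop))
    refine (ho.measure_pos volume ⟨y₀, hu, hξ⟩).trans_le (measure_mono fun y hy ↦ ?_)
    have hy0 : 0 < ‖y‖ := norm_pos_iff.2 fun h ↦ hy.1 (by simp [h])
    have h1 : 1 - cos (2 * π * ⟪y, ξ⟫) ≠ 0 := sub_ne_zero.2 hy.2.symm
    have := hy.1
    simp only [Function.mem_support, lameIntegrand]
    positivity

theorem integral_one_sub_cos_gaussianReal (x : ℝ) :
    ∫ t, (1 - cos (x * t)) ∂ProbabilityTheory.gaussianReal 0 1 = 1 - exp (-(x ^ 2 / 2)) := by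
  set γ := ProbabilityTheory.gaussianReal 0 1
  have hc : Integrable (fun t : ℝ ↦ cos (x * t)) γ :=
    (integrable_const (1 : ℝ)).mono' (by fun_prop) (.of_forall fun t ↦ abs_cos_le_one _)
  have hexp : Integrable (fun t : ℝ ↦ Complex.exp (x * t * Complex.I)) γ :=
    (integrable_const (1 : ℝ)).mono' (by fun_prop) (.of_forall fun t ↦ by
      rw [← Complex.ofReal_mul, Complex.norm_exp_ofReal_mul_I])
  have h := ProbabilityTheory.charFun_gaussianReal (μ := 0) (v := 1) x
  rw [charFun_apply_real] at h
  have h2 := congrArg Complex.re h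
  have h3 := integral_re hexp
  simp only [RCLike.re_to_complex] at h3
  rw [← h3] at h2
  have h4 : ∀ t : ℝ, (Complex.exp (x * t * Complex.I)).re = cos (x * t) := fun t ↦ by
    rw [← Complex.ofReal_mul, Complex.exp_ofReal_mul_I_re]
  simp only [h4] at h2
  rw [integral_sub (integrable_const _) hc, h2]
  simp only [integral_const, probReal_univ, smul_eq_mul, mul_one, sub_right_inj]
  rw [← Complex.exp_ofReal_re]
  congr 2
  push_cast
  simp

/-- The symbol at a unit vector is larger in the longitudinal direction than in a transversal
one. -/
theorem lameForm_transversal_lt_longitudinal [Nontrivial E] {s : ℝ} (hs : s ∈ Set.Ioo (0 : ℝ) 1)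
    {e w : E} (he : ‖e‖ = 1) (hw : ‖w‖ = 1) (hew : ⟪e, w⟫ = 0) :
    lameForm s e w w < lameForm s e e e := by
  by_contra! hle
  set γ := ProbabilityTheory.gaussianReal 0 1
  set φ : ℝ → ℝ := fun x ↦ 1 - exp (-((2 * π * x) ^ 2 / 2)) with hφ
  set h : E → ℝ := fun y ↦ (⟪y, e⟫ ^ 2 - ⟪y, w⟫ ^ 2) / ‖y‖ ^ 2 *
    ‖y‖ ^ (-((finrank ℝ E : ℝ) + 2 * s)) with hh
  have hprod : Integrable (Function.uncurry fun (t : ℝ) (y : E) ↦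
      lameIntegrand s (t • e) e e y - lameIntegrand s (t • e) w w y) (γ.prod volume) := by
    have hg : Integrable (fun t : ℝ ↦ 2 * (2 + (2 * π) ^ 2 * t ^ 2)) γ :=
      ((integrable_const _).add
        ((ProbabilityTheory.memLp_id_gaussianReal 2).integrable_sq.const_mul _)).const_mul _
    refine (hg.mul_prod (integrable_truncatedKernel (E := E) hs)).mono' ?_ (.of_forall ?_)
    · simp only [Function.uncurry_def, lameIntegrand]
      fun_prop
    · rintro ⟨t, y⟩
      have h1 := abs_lameIntegrand_smul_le s t e e e y
      have h2 := abs_lameIntegrand_smul_le s t e w w y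
      rw [he, mul_one] at h1 h2
      rw [hw] at h2
      refine (abs_sub _ _).trans ?_
      simp only [mul_one, one_mul] at h1 h2 ⊢
      linarith
  have hinner : ∀ y : E, ∫ t, (lameIntegrand s (t • e) e e y - lameIntegrand s (t • e) w w y) ∂γ =
      h y * φ ⟪y, e⟫ := by
    intro y
    rw [hφ]
    simp only
    rw [← integral_one_sub_cos_gaussianReal, ← integral_const_mul]
    congr 1 with t
    simp only [lameIntegrand, hh, inner_smul_right]
    rw [show 2 * π * ⟪y, e⟫ * t = 2 * π * (t * ⟪y, e⟫) by ring]
    ring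
  have hI : Integrable fun y : E ↦ h y * φ ⟪y, e⟫ := by
    simpa only [Function.uncurry_apply_pair, hinner] using hprod.integral_prod_right
  have hswap := integral_integral_swap hprod
  simp only [hinner] at hswap
  have hnonpos : ∫ y, h y * φ ⟪y, e⟫ ≤ 0 := by
    rw [← hswap]
    refine integral_nonpos fun t ↦ ?_
    simp only [Pi.zero_apply]
    rw [integral_sub (integrable_lameIntegrand hs _ _ _) (integrable_lameIntegrand hs _ _ _)]
    change lameForm s (t • e) e e - lameForm s (t • e) w w ≤ 0
    rw [lameForm_smul hs.1, lameForm_smul hs.1, ← mul_sub]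
    exact mul_nonpos_of_nonneg_of_nonpos (by positivity) (by linarith)
  set L := reflection (ℝ ∙ (e - w))ᗮ with hL
  have hLe : L e = w := reflection_sub (he.trans hw.symm)
  have hLw : L w = e := by rw [← hLe, hL, reflection_reflection]
  have hLye : ∀ y : E, ⟪L y, e⟫ = ⟪y, w⟫ := fun y ↦ by
    rw [← hLw, L.inner_map_map]
  have hLyw : ∀ y : E, ⟪L y, w⟫ = ⟪y, e⟫ := fun y ↦ by
    rw [← hLe, L.inner_map_map]
  have hLh : ∀ y : E, h (L y) * φ ⟪L y, e⟫ = -(h y * φ ⟪y, w⟫) := fun y ↦ by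
    rw [hLye]
    simp only [hh, hLye, hLyw, L.norm_map]
    ring
  have hemb := L.toHomeomorph.measurableEmbedding
  have hswap' : ∫ y, -(h y * φ ⟪y, w⟫) = ∫ y, h y * φ ⟪y, e⟫ := by
    rw [← L.measurePreserving.integral_comp hemb (fun y ↦ h y * φ ⟪y, e⟫)]
    simp only [hLh]
  have hI' : Integrable fun y : E ↦ -(h y * φ ⟪y, w⟫) := by
    have := (L.measurePreserving.integrable_comp_emb hemb).2 hI
    simpa only [Function.comp_def, hLh] using this
  have hcomp : ∀ {a b : ℝ}, a ^ 2 < b ^ 2 → φ a < φ b := by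
    intro a b hab
    simp only [hφ]
    have : (2 * π * a) ^ 2 < (2 * π * b) ^ 2 := by
      rw [mul_pow, mul_pow (2 * π) b]; gcongr
    gcongr
  have hval : ∀ y : E, h y * φ ⟪y, e⟫ + -(h y * φ ⟪y, w⟫) =
      (⟪y, e⟫ ^ 2 - ⟪y, w⟫ ^ 2) * (φ ⟪y, e⟫ - φ ⟪y, w⟫) *
        (‖y‖ ^ (-((finrank ℝ E : ℝ) + 2 * s)) / ‖y‖ ^ 2) := fun y ↦ by
    simp only [hh]
    ring
  have hsign : ∀ a b : ℝ, a ^ 2 ≠ b ^ 2 → 0 < (a ^ 2 - b ^ 2) * (φ a - φ b) := by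
    intro a b hab
    rcases hab.lt_or_gt with hlt | hlt
    · exact mul_pos_of_neg_of_neg (sub_neg.2 hlt) (sub_neg.2 (hcomp hlt))
    · exact mul_pos (sub_pos.2 hlt) (sub_pos.2 (hcomp hlt))
  have hpos : 0 < ∫ y, (h y * φ ⟪y, e⟫ + -(h y * φ ⟪y, w⟫)) := by
    refine (integral_pos_iff_support_of_nonneg (fun y ↦ ?_) (hI.add hI')).2 ?_
    · change 0 ≤ h y * φ ⟪y, e⟫ + -(h y * φ ⟪y, w⟫)
      rw [hval]
      refine mul_nonneg ?_ (by positivity)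
      by_cases hy : ⟪y, e⟫ ^ 2 = ⟪y, w⟫ ^ 2
      · simp [hy]
      · exact (hsign _ _ hy).le
    · have ho : IsOpen {y : E | ⟪y, e⟫ ^ 2 ≠ ⟪y, w⟫ ^ 2} :=
        isOpen_ne_fun (by fun_prop) (by fun_prop)
      refine (ho.measure_pos volume ⟨e, ?_⟩).trans_le (measure_mono fun y hy ↦ ?_)
      · simp [he, hew]
      · have hy0 : 0 < ‖y‖ := norm_pos_iff.2 fun h0 ↦ hy (by simp [h0])
        change h y * φ ⟪y, e⟫ + -(h y * φ ⟪y, w⟫) ≠ 0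
        rw [hval]
        exact (mul_pos (hsign _ _ hy) (by positivity)).ne'
  rw [integral_add hI hI', hswap'] at hpos
  linarith

theorem lameForm_longitudinal_eq (s : ℝ) {e e' : E} (he : ‖e‖ = 1) (he' : ‖e'‖ = 1) :
    lameForm s e' e' e' = lameForm s e e e := by
  rw [← reflection_sub (he.trans he'.symm), lameForm_map]

theorem lameForm_transversal_eq (s : ℝ) {e w e' w' : E} (he : ‖e‖ = 1) (hw : ‖w‖ = 1)
    (hew : ⟪e, w⟫ = 0) (he' : ‖e'‖ = 1) (hw' : ‖w'‖ = 1) (hew' : ⟪e', w'⟫ = 0) :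
    lameForm s e' w' w' = lameForm s e w w := by
  set L := reflection (ℝ ∙ (e - e'))ᗮ
  have hLe : L e = e' := reflection_sub (he.trans he'.symm)
  set R := reflection (ℝ ∙ (L w - w'))ᗮ
  have hRw : R (L w) = w' := reflection_sub (by rw [L.norm_map, hw, hw'])
  have hRe : R e' = e' := reflection_sub_apply_of_inner_eq_zero
    (by rw [← hLe, L.inner_map_map, real_inner_comm, hew]) (by rw [real_inner_comm, hew'])
  rw [← lameForm_map s L e w w, hLe, ← lameForm_map s R e' (L w) (L w), hRe, hRw]

theorem lameForm_mixed_eq_zero (s : ℝ) {e w : E} (hew : ⟪e, w⟫ = 0) : lameForm s e e w = 0 := by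
  have hRe : reflection (ℝ ∙ w)ᗮ e = e :=
    reflection_mem_subspace_eq_self <| mem_orthogonal_singleton_iff_inner_right.2 <| by
      rw [real_inner_comm, hew]
  have h := lameForm_map s (reflection (ℝ ∙ w)ᗮ) e e w
  rw [hRe, reflection_orthogonalComplement_singleton_eq_neg, lameForm_comm, ← neg_one_smul ℝ w,
    lameForm_smul_left, lameForm_comm] at h
  linarith

theorem exists_lameForm_transversal [Nontrivial E] {s : ℝ} (hs : s ∈ Set.Ioo (0 : ℝ) 1) {e₀ : E}
    (he₀ : ‖e₀‖ = 1) : ∃ c, 0 < c ∧ c < lameForm s e₀ e₀ e₀ ∧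
      ∀ e w : E, ‖e‖ = 1 → ‖w‖ = 1 → ⟪e, w⟫ = 0 → lameForm s e w w = c := by
  by_cases h : ∃ e w : E, ‖e‖ = 1 ∧ ‖w‖ = 1 ∧ ⟪e, w⟫ = 0
  · obtain ⟨e, w, he, hw, hew⟩ := h
    refine ⟨lameForm s e w w, lameForm_self_pos hs (y₀ := w + (1 / 2 : ℝ) • e) ?_ ?_, ?_,
      fun e' w' he' hw' hew' ↦ lameForm_transversal_eq s he hw hew he' hw' hew'⟩
    · simp [inner_add_left, inner_smul_left, hw, hew]
    · have : 2 * π * ⟪w + (1 / 2 : ℝ) • e, e⟫ = π := by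
        simp [inner_add_left, inner_smul_left, he, real_inner_comm e w, hew]
        ring
      rw [this, cos_pi]
      norm_num
    · rw [lameForm_longitudinal_eq s he he₀]
      exact lameForm_transversal_lt_longitudinal hs he hw hew
  · have hpos : 0 < lameForm s e₀ e₀ e₀ := by
      refine lameForm_self_pos hs (y₀ := (1 / 2 : ℝ) • e₀) ?_ ?_
      · simp [inner_smul_left, he₀]
      · have : 2 * π * ⟪(1 / 2 : ℝ) • e₀, e₀⟫ = π := by
          simp [inner_smul_left, he₀]
          ring
        rw [this, cos_pi]
        norm_num
    exact ⟨_, half_pos hpos, half_lt_self hpos, fun e w he hw hew ↦ (h ⟨e, w, he, hw, hew⟩).elim⟩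

theorem exists_lameForm_self_eq [Nontrivial E] {s : ℝ} (hs : s ∈ Set.Ioo (0 : ℝ) 1) :
    ∃ a > (0 : ℝ), ∃ b > (0 : ℝ), ∀ e u : E, ‖e‖ = 1 →
      lameForm s e u u = a * ‖u‖ ^ 2 + b * ⟪e, u⟫ ^ 2 := by
  obtain ⟨e₀, he₀⟩ := exists_norm_eq E zero_le_one
  obtain ⟨c, hc, hlt, htr⟩ := exists_lameForm_transversal hs he₀
  refine ⟨c, hc, lameForm s e₀ e₀ e₀ - c, sub_pos.2 hlt, fun e u he ↦ ?_⟩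
  set w := u - ⟪e, u⟫ • e with hw
  have hew : ⟪e, w⟫ = 0 := by
    rw [hw, inner_sub_right, inner_smul_right, real_inner_self_eq_norm_sq, he]; ring
  have hu : u = ⟪e, u⟫ • e + w := by rw [hw]; abel
  have hww : lameForm s e w w = c * ‖w‖ ^ 2 := by
    rcases eq_or_ne w 0 with h0 | h0
    · simp [h0, lameForm, lameIntegrand]
    · have hn : ‖w‖ ≠ 0 := norm_ne_zero_iff.2 h0
      have h1 := htr e (‖w‖⁻¹ • w) he (by rw [norm_smul, norm_inv, norm_norm, inv_mul_cancel₀ hn])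
        (by rw [inner_smul_right, hew, mul_zero])
      rw [lameForm_smul_left, lameForm_comm, lameForm_smul_left] at h1
      field_simp at h1
      linarith
  have hnorm : ‖u‖ ^ 2 = ⟪e, u⟫ ^ 2 + ‖w‖ ^ 2 := by
    rw [hw, norm_sub_sq_real, norm_smul, inner_smul_right, real_inner_comm, he, mul_one,
      norm_eq_abs, sq_abs]
    ring
  have hmix := lameForm_mixed_eq_zero s hew
  have hlong := lameForm_longitudinal_eq s he₀ he
  have hexp : lameForm s e u u = ⟪e, u⟫ ^ 2 * lameForm s e e e + lameForm s e w w := by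
    generalize ⟪e, u⟫ = r at hu
    rw [hu, lameForm_add_left hs, lameForm_smul_left, lameForm_comm s e e, lameForm_comm s e w,
      lameForm_add_left hs, lameForm_add_left hs, lameForm_smul_left, lameForm_smul_left,
      lameForm_comm s e w e, hmix]
    ring
  rw [hexp, hww, hnorm, hlong]
  ring

/-- The symbol of the fractional Navier–Lamé operator as a bilinear form. -/
theorem exists_lameForm_eq [Nontrivial E] {s : ℝ} (hs : s ∈ Set.Ioo (0 : ℝ) 1) :
    ∃ a > (0 : ℝ), ∃ b > (0 : ℝ), ∀ ξ u v : E, ξ ≠ 0 →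
      lameForm s ξ u v = ‖ξ‖ ^ (2 * s) * (a * ⟪u, v⟫ + b * (⟪ξ, u⟫ * ⟪ξ, v⟫ / ‖ξ‖ ^ 2)) := by
  obtain ⟨a, ha, b, hb, hab⟩ := exists_lameForm_self_eq (E := E) hs
  refine ⟨a, ha, b, hb, fun ξ u v hξ ↦ ?_⟩
  have hn : 0 < ‖ξ‖ := norm_pos_iff.2 hξ
  set e := ‖ξ‖⁻¹ • ξ with he
  have he1 : ‖e‖ = 1 := by rw [he, norm_smul, norm_inv, norm_norm, inv_mul_cancel₀ hn.ne']
  have hξe : ξ = ‖ξ‖ • e := by rw [he, smul_inv_smul₀ hn.ne']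
  have hpol : lameForm s e (u + v) (u + v) =
      lameForm s e u u + 2 * lameForm s e u v + lameForm s e v v := by
    rw [lameForm_add_left hs, lameForm_comm s e u, lameForm_comm s e v, lameForm_add_left hs,
      lameForm_add_left hs, lameForm_comm s e v u]
    ring
  rw [hab _ _ he1, hab _ _ he1, hab _ _ he1, norm_add_sq_real, inner_add_right] at hpol
  have hform : lameForm s e u v = a * ⟪u, v⟫ + b * (⟪e, u⟫ * ⟪e, v⟫) := by linarith
  rw [show lameForm s ξ u v = lameForm s (‖ξ‖ • e) u v by rw [← hξe], lameForm_smul_of_pos s hn,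
    hform, he, inner_smul_left, inner_smul_left]
  simp only [conj_trivial]
  field_simp

end LameForm

/-- The Fourier symbol of the fractional Navier–Lamé operator `-(-Δ̊)^s` with kernel
`|y|^{-(d+2s)} (y⊗y/|y|²)`: there are positive constants `ℓ₁, ℓ₂` (depending only on `d, s`)
such that for every `ξ ≠ 0` the symbol matrix
`M^Δ_s(ξ) = ∫ (y⊗y/|y|²)(1 - cos(2π y·ξ))|y|^{-(d+2s)} dy` equals
`(2π|ξ|)^{2s}(ℓ₁ I + ℓ₂ ξ⊗ξ/|ξ|²)`. -/
theorem fractional_lame_symbol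
    (d : ℕ) (hd : 1 ≤ d) (s : ℝ) (hs : s ∈ Set.Ioo (0:ℝ) 1) :
    ∃ ℓ₁ > (0:ℝ), ∃ ℓ₂ > (0:ℝ),
      ∀ ξ : EuclideanSpace ℝ (Fin d), ξ ≠ 0 → ∀ i j : Fin d,
        (∫ y : EuclideanSpace ℝ (Fin d),
            (y i * y j / ‖y‖ ^ 2) * (1 - Real.cos (2 * Real.pi * ∑ k, y k * ξ k)) *
              ‖y‖ ^ (-((d : ℝ) + 2 * s)))
          = (2 * Real.pi * ‖ξ‖) ^ (2 * s) *
              (ℓ₁ * (if i = j then 1 else 0) + ℓ₂ * (ξ i * ξ j / ‖ξ‖ ^ 2)) := by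
  have : Nonempty (Fin d) := ⟨⟨0, hd⟩⟩
  obtain ⟨a, ha, b, hb, hab⟩ := exists_lameForm_eq (E := EuclideanSpace ℝ (Fin d)) hs
  have hc : 0 < (2 * π) ^ (2 * s) := by positivity
  refine ⟨a / (2 * π) ^ (2 * s), by positivity, b / (2 * π) ^ (2 * s), by positivity,
    fun ξ hξ i j ↦ ?_⟩
  have h := hab ξ (EuclideanSpace.single i 1) (EuclideanSpace.single j 1) hξ
  have hsum : ∀ y : EuclideanSpace ℝ (Fin d), inner ℝ y ξ = ∑ k, y k * ξ k := fun y ↦ by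
    simp [PiLp.inner_apply, mul_comm]
  simp only [lameForm, lameIntegrand, EuclideanSpace.inner_single_right, conj_trivial, one_mul,
    finrank_euclideanSpace_fin, hsum] at h
  rw [h, mul_rpow (by positivity) (norm_nonneg ξ)]
  have hij : (EuclideanSpace.single i (1 : ℝ) : EuclideanSpace ℝ (Fin d)) j =
      if i = j then 1 else 0 := by
    simp [eq_comm]
  rw [hij]
  field_simp
end
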